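/- Let S be a nonempty finite set (of half edges), γ : S → {1,…,D} a coloring with D ≥ 1, σ a permutation of S, and α a fixed-point-free involution of S with γ(α(h)) = γ(h) for all h (so that the orbits of α are the edges, each carrying a single color). For each color c let α_c be the permutation of S acting as α on γ⁻¹(c) and as the identity elsewhere. Define V = the number of orbits (cycles, counting fixed points) of σ, E = |S|/2, and F = Σ_{c=1}^D (number of orbits of σ∘α_c). Assume the subgroup of permutations of S generated by σ and α acts transitively on S (the map is connected). Then F ≤ 2 + (D − 2)·V + E. -/

import Mathlib

noncomputable section

/-- Given a coloring `γ : S → {1,…,D}` of the half edges and a color-preserving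
permutation `α`, the permutation `α_c` acting as `α` on the half edges of color `c`
and as the identity elsewhere. -/
def colorRestrict {S : Type*} {D : ℕ} (γ : S → Fin D) (α : Equiv.Perm S)
    (hcol : ∀ h, γ (α h) = γ h) (c : Fin D) : Equiv.Perm S where
  toFun h := if γ h = c then α h else h
  invFun h := if γ h = c then α⁻¹ h else h
  left_inv h := by
    by_cases hc : γ h = c
    · simp [hc, hcol h]
    · simp [hc]
  right_inv h := by
    by_cases hc : γ h = c
    · have hγ : γ (α⁻¹ h) = γ h := by
        exact (hcol (α⁻¹ h)).symm.trans (congrArg γ (Equiv.apply_symm_apply α h))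
      simp [hc, show γ (α.symm h) = γ h from hγ]
    · simp [hc]

/-- The number of orbits (cycles, counting fixed points) of a permutation `π` of a
finite set: the number of nontrivial cycles plus the number of fixed points. -/
def numCycles {S : Type*} [Fintype S] [DecidableEq S] (π : Equiv.Perm S) : ℕ :=
  Multiset.card π.cycleType + (Fintype.card S - π.support.card)

namespace Setoid

variable {S : Type*}

/-- The number of equivalence classes of a setoid. -/
def numClasses (r : Setoid S) : ℕ := Nat.card (Quotient r)

theorem numClasses_ker {T : Type*} (f : S → T) : (ker f).numClasses = (Set.range f).ncard :=
  Nat.card_congr (quotientKerEquivRange f)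

theorem numClasses_eq_one [Nonempty S] {r : Setoid S} (h : ∀ x y, r x y) : r.numClasses = 1 := by
  rw [numClasses, Nat.card_eq_one_iff_unique]
  exact ⟨⟨fun p q => Quotient.inductionOn₂ p q fun x y => Quotient.sound (h x y)⟩,
    ⟨Quotient.mk r (Classical.arbitrary S)⟩⟩

theorem numClasses_le_of_le [Finite S] {r s : Setoid S} (h : r ≤ s) :
    s.numClasses ≤ r.numClasses :=
  Nat.card_le_card_of_surjective (Quotient.map' id h)
    (fun q => Quotient.inductionOn q fun x => ⟨Quotient.mk r x, rfl⟩)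

open Classical in
/-- The finest setoid coarser than `r` that identifies `a` and `b`. -/
def join (r : Setoid S) (a b : S) : Setoid S :=
  ker fun x => if r x b then Quotient.mk r a else Quotient.mk r x

theorem join_le_iff {r s : Setoid S} {a b : S} : r.join a b ≤ s ↔ r ≤ s ∧ s a b := by
  classical
  constructor
  · intro h
    refine ⟨fun x y hxy => h ?_, h ?_⟩
    · have hb : r x b ↔ r y b := ⟨r.trans (r.symm hxy), r.trans hxy⟩
      change (if r x b then Quotient.mk r a else Quotient.mk r x) =
        if r y b then Quotient.mk r a else Quotient.mk r y
      rw [if_congr hb rfl (Quotient.sound hxy)]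
    · change (if r a b then Quotient.mk r a else Quotient.mk r a) =
        if r b b then Quotient.mk r a else Quotient.mk r b
      rw [if_pos (r.refl b), ite_self]
  · rintro ⟨hrs, hab⟩ x y hxy
    change (if r x b then Quotient.mk r a else Quotient.mk r x) =
      (if r y b then Quotient.mk r a else Quotient.mk r y) at hxy
    split_ifs at hxy with hx hy hy
    · exact s.trans (hrs hx) (s.symm (hrs hy))
    · exact s.trans (hrs hx) (s.trans (s.symm hab) (hrs (Quotient.exact hxy)))
    · exact s.trans (hrs (Quotient.exact hxy)) (s.trans hab (s.symm (hrs hy)))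
    · exact hrs (Quotient.exact hxy)

theorem join_eq_self {r : Setoid S} {a b : S} (h : r a b) : r.join a b = r :=
  le_antisymm (join_le_iff.2 ⟨le_rfl, h⟩) (join_le_iff.1 le_rfl).1

theorem numClasses_join_add_one [Finite S] {r : Setoid S} {a b : S} (h : ¬ r a b) :
    (r.join a b).numClasses + 1 = r.numClasses := by
  classical
  have hrange : (Set.range fun x => if r x b then Quotient.mk r a else Quotient.mk r x) =
      {Quotient.mk r b}ᶜ := by
    ext q
    induction q using Quotient.inductionOn with | _ y => ?_
    simp only [Set.mem_range, Set.mem_compl_iff, Set.mem_singleton_iff]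
    constructor
    · rintro ⟨x, hx⟩ hy
      rw [hy] at hx
      split_ifs at hx with hxb
      · exact h (Quotient.exact hx)
      · exact hxb (Quotient.exact hx)
    · intro hy
      exact ⟨y, if_neg fun hyb => hy (Quotient.sound hyb)⟩
  rw [join, numClasses_ker, hrange, numClasses, ← Set.ncard_add_ncard_compl {Quotient.mk r b},
    Set.ncard_singleton, add_comm]

theorem numClasses_le_numClasses_join_add_one [Finite S] (r : Setoid S) (a b : S) :
    r.numClasses ≤ (r.join a b).numClasses + 1 := by
  by_cases h : r a b
  · rw [join_eq_self h]
    exact Nat.le_succ _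
  · exact (numClasses_join_add_one h).ge

end Setoid

namespace Equiv.Perm

variable {S : Type*}

theorem sameCycleSetoid_le_iff [Finite S] {π : Perm S} {s : Setoid S} :
    SameCycle.setoid π ≤ s ↔ ∀ x, s x (π x) := by
  constructor
  · exact fun h x => h (sameCycle_apply_right.2 (SameCycle.refl π x))
  · intro h x y hxy
    obtain ⟨n, rfl⟩ := SameCycle.exists_nat_pow_eq hxy
    clear hxy
    induction n with
    | zero => exact s.refl x
    | succ n ih =>
      rw [pow_succ', mul_apply]
      exact s.trans ih (h _)

theorem join_sameCycleSetoid_mul_swap [Finite S] [DecidableEq S] (π : Perm S) (a b : S) :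
    (SameCycle.setoid (π * swap a b)).join a b = (SameCycle.setoid π).join a b := by
  refine eq_of_forall_ge_iff fun s => ?_
  simp only [Setoid.join_le_iff, sameCycleSetoid_le_iff, mul_apply]
  refine and_congr_left fun hab => ?_
  have hswap : ∀ x, s x (swap a b x) := by
    intro x
    rcases eq_or_ne x a with rfl | hxa
    · rwa [swap_apply_left]
    rcases eq_or_ne x b with rfl | hxb
    · rw [swap_apply_right]
      exact s.symm hab
    · rw [swap_apply_of_ne_of_ne hxa hxb]
  constructor
  · intro h x
    have := h (swap a b x)
    rw [swap_apply_self] at this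
    exact s.trans (hswap x) this
  · exact fun h x => s.trans (hswap x) (h _)

/-- The partition into the connected components of the pair `(σ, α)`. -/
def components (σ α : Perm S) : Setoid S :=
  sInf {s | ∀ x, s x (σ x) ∧ s x (α x)}

theorem components_apply_left (σ α : Perm S) (x : S) : components σ α x (σ x) :=
  fun _ hs => (hs x).1

theorem components_apply_right (σ α : Perm S) (x : S) : components σ α x (α x) :=
  fun _ hs => (hs x).2

theorem components_le_iff {σ α : Perm S} {s : Setoid S} :
    components σ α ≤ s ↔ ∀ x, s x (σ x) ∧ s x (α x) :=
  ⟨fun h x => ⟨h (components_apply_left σ α x), h (components_apply_right σ α x)⟩,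
    fun h => sInf_le h⟩

theorem components_one_right [Finite S] (σ : Perm S) : components σ 1 = SameCycle.setoid σ := by
  refine eq_of_forall_ge_iff fun s => ?_
  rw [components_le_iff, sameCycleSetoid_le_iff]
  exact forall_congr' fun x => and_iff_left (s.refl x)

theorem components_mul_swap [DecidableEq S] {σ α : Perm S} {a b : S} (ha : α a = a)
    (hb : α b = b) : components σ (α * swap a b) = (components σ α).join a b := by
  refine eq_of_forall_ge_iff fun s => ?_
  simp only [Setoid.join_le_iff, components_le_iff, mul_apply]
  constructor
  · intro h
    have hab := (h a).2
    rw [swap_apply_left, hb] at hab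
    refine ⟨fun x => ⟨(h x).1, ?_⟩, hab⟩
    rcases eq_or_ne x a with rfl | hxa
    · rw [ha]
    rcases eq_or_ne x b with rfl | hxb
    · rw [hb]
    · have := (h x).2
      rwa [swap_apply_of_ne_of_ne hxa hxb] at this
  · rintro ⟨h, hab⟩ x
    refine ⟨(h x).1, ?_⟩
    rcases eq_or_ne x a with rfl | hxa
    · rwa [swap_apply_left, hb]
    rcases eq_or_ne x b with rfl | hxb
    · rw [swap_apply_right, ha]
      exact s.symm hab
    · rw [swap_apply_of_ne_of_ne hxa hxb]
      exact (h x).2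

theorem components_of_mem_closure {σ α π : Perm S}
    (hπ : π ∈ Subgroup.closure ({σ, α} : Set (Perm S))) (x : S) :
    components σ α x (π x) := by
  induction hπ using Subgroup.closure_induction generalizing x with
  | mem τ hτ =>
    rcases hτ with rfl | rfl
    · exact components_apply_left _ _ x
    · exact components_apply_right _ _ x
  | one => exact (components σ α).refl x
  | mul τ ρ _ _ hτ hρ => exact (components σ α).trans (hρ x) (hτ (ρ x))
  | inv τ _ hτ =>
    have := hτ (τ⁻¹ x)
    rw [← mul_apply, mul_inv_cancel, one_apply] at this
    exact (components σ α).symm this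

variable [Fintype S] [DecidableEq S]

theorem numClasses_sameCycleSetoid (π : Perm S) :
    (SameCycle.setoid π).numClasses = numCycles π := by
  let f : S → Perm S ⊕ S := fun x => if x ∈ π.support then .inl (π.cycleOf x) else .inr x
  have hker : SameCycle.setoid π = Setoid.ker f := by
    ext x y
    change SameCycle π x y ↔ f x = f y
    constructor
    · intro h
      by_cases hx : x ∈ π.support
      · have hy : y ∈ π.support := h.mem_support_iff.1 hx
        simp only [f, if_pos hx, if_pos hy, h.cycleOf_eq]
      · rw [h.eq_of_left (notMem_support.1 hx)]
    · intro h
      by_cases hx : x ∈ π.support <;> by_cases hy : y ∈ π.support <;>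
        simp only [f, hx, hy, if_true, if_false, Sum.inl.injEq, Sum.inr.injEq, reduceCtorEq] at h
      · exact (sameCycle_iff_cycleOf_eq_of_mem_support hx hy).2 h
      · exact h ▸ SameCycle.refl π x
  have hrange : Set.range f = ↑(π.cycleFactorsFinset.disjSum π.supportᶜ) := by
    ext z
    rcases z with c | x
    · simp only [Set.mem_range, Finset.mem_coe, Finset.inl_mem_disjSum]
      constructor
      · rintro ⟨x, hx⟩
        by_cases hxs : x ∈ π.support
        · simp only [f, if_pos hxs, Sum.inl.injEq] at hx
          exact hx ▸ cycleOf_mem_cycleFactorsFinset_iff.2 hxs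
        · simp only [f, if_neg hxs, reduceCtorEq] at hx
      · intro hc
        obtain ⟨x, hx⟩ := (mem_cycleFactorsFinset_iff.1 hc).1.nonempty_support
        refine ⟨x, ?_⟩
        simp only [f, if_pos (mem_cycleFactorsFinset_support_le hc hx),
          cycle_is_cycleOf hx hc]
    · simp only [Set.mem_range, Finset.mem_coe, Finset.inr_mem_disjSum, Finset.mem_compl]
      constructor
      · rintro ⟨y, hy⟩
        by_cases hys : y ∈ π.support
        · simp only [f, if_pos hys, reduceCtorEq] at hy
        · simp only [f, if_neg hys, Sum.inr.injEq] at hy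
          exact hy ▸ hys
      · exact fun hx => ⟨x, if_neg hx⟩
  rw [hker, Setoid.numClasses_ker, hrange, Set.ncard_coe_finset, Finset.card_disjSum,
    Finset.card_compl, numCycles, cycleType_def, Multiset.card_map, Finset.card_val]

theorem sign_eq_neg_one_pow_card_add_numCycles (π : Perm S) :
    sign π = (-1) ^ (Fintype.card S + numCycles π) := by
  have hle : π.support.card ≤ Fintype.card S := Finset.card_le_univ _
  rw [sign_of_cycleType, sum_cycleType, numCycles]
  have h : Fintype.card S + (π.cycleType.card + (Fintype.card S - π.support.card)) =
      π.support.card + π.cycleType.card + 2 * (Fintype.card S - π.support.card) := by omega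
  rw [h, pow_add _ _ (2 * _), pow_mul]
  simp

theorem numCycles_mul_swap_le (π : Perm S) (a b : S) :
    numCycles (π * swap a b) ≤ numCycles π + 1 := by
  rw [← numClasses_sameCycleSetoid, ← numClasses_sameCycleSetoid]
  calc _ ≤ ((SameCycle.setoid (π * swap a b)).join a b).numClasses + 1 :=
        Setoid.numClasses_le_numClasses_join_add_one _ a b
    _ = ((SameCycle.setoid π).join a b).numClasses + 1 := by rw [join_sameCycleSetoid_mul_swap]
    _ ≤ _ := Nat.add_le_add_right
        (Setoid.numClasses_le_of_le (Setoid.join_le_iff.1 le_rfl).1) 1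

theorem numCycles_mul_swap_add_one_of_not_sameCycle {π : Perm S} {a b : S}
    (h : ¬ SameCycle π a b) : numCycles (π * swap a b) + 1 = numCycles π := by
  have hab : a ≠ b := fun hab => h (hab ▸ SameCycle.refl π a)
  have hjoin : ((SameCycle.setoid π).join a b).numClasses + 1 = numCycles π := by
    rw [← numClasses_sameCycleSetoid]
    exact Setoid.numClasses_join_add_one h
  have hle : ((SameCycle.setoid π).join a b).numClasses ≤ numCycles (π * swap a b) := by
    rw [← numClasses_sameCycleSetoid, ← join_sameCycleSetoid_mul_swap]
    exact Setoid.numClasses_le_of_le (Setoid.join_le_iff.1 le_rfl).1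
  have hge : numCycles (π * swap a b) ≤ ((SameCycle.setoid π).join a b).numClasses + 1 := by
    rw [← numClasses_sameCycleSetoid, ← join_sameCycleSetoid_mul_swap]
    exact Setoid.numClasses_le_numClasses_join_add_one _ a b
  have hne : numCycles (π * swap a b) ≠ numCycles π := by
    intro heq
    have hsign : sign (π * swap a b) = sign π := by
      rw [sign_eq_neg_one_pow_card_add_numCycles, sign_eq_neg_one_pow_card_add_numCycles π, heq]
    rw [sign_mul, sign_swap hab, mul_eq_left] at hsign
    exact absurd hsign (by decide)
  omega

end Equiv.Perm

open Equiv Equiv.Perm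

section FaceCounting

variable {S : Type*} {D : ℕ} {γ : S → Fin D}

theorem colorRestrict_apply {α : Perm S} (hcol : ∀ h, γ (α h) = γ h) (c : Fin D) (x : S) :
    colorRestrict γ α hcol c x = if γ x = c then α x else x := rfl

theorem colorRestrict_one (hcol : ∀ h, γ ((1 : Perm S) h) = γ h) (c : Fin D) :
    colorRestrict γ 1 hcol c = 1 := by
  ext x
  simp [colorRestrict_apply]

theorem colorRestrict_mul_swap [DecidableEq S] {α : Perm S} {a b : S} (hab : γ a = γ b)
    (hcol : ∀ h, γ (α h) = γ h) (hcol' : ∀ h, γ ((α * swap a b) h) = γ h) (c : Fin D) :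
    colorRestrict γ (α * swap a b) hcol' c =
      colorRestrict γ α hcol c * if γ a = c then swap a b else 1 := by
  ext x
  by_cases hc : γ a = c
  · have hγ : γ (swap a b x) = γ x := by
      rw [swap_apply_def]
      split_ifs with hxa hxb
      · rw [hxa, hab]
      · rw [hxb, hab]
      · rfl
    simp only [if_pos hc, mul_apply, colorRestrict_apply, hγ]
    split_ifs with hx
    · rfl
    · rw [swap_apply_of_ne_of_ne]
      · rintro rfl
        exact hx hc
      · rintro rfl
        exact hx (hab ▸ hc)
  · simp only [if_neg hc, mul_one, mul_apply, colorRestrict_apply]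
    split_ifs with hx
    · rw [swap_apply_of_ne_of_ne]
      · rintro rfl
        exact hc hx
      · rintro rfl
        exact hc (hab.trans hx)
    · rfl

theorem sameCycleSetoid_mul_colorRestrict_le [Finite S] (σ : Perm S) {α : Perm S}
    (hcol : ∀ h, γ (α h) = γ h) (c : Fin D) :
    SameCycle.setoid (σ * colorRestrict γ α hcol c) ≤ components σ α := by
  refine sameCycleSetoid_le_iff.2 fun x => ?_
  rw [mul_apply, colorRestrict_apply]
  split_ifs
  · exact (components σ α).trans (components_apply_right σ α x) (components_apply_left σ α _)
  · exact components_apply_left σ α x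

variable [Fintype S] [DecidableEq S]

/-- Adding an edge `{a, b}` changes the face count by at most one, and decreases it by one when
the edge connects two components. -/
theorem sum_numCycles_mul_swap_le (σ : Perm S) {α : Perm S} {a b : S} (ha : α a = a)
    (hb : α b = b) (hab : γ a = γ b) (hcol : ∀ h, γ (α h) = γ h)
    (hcol' : ∀ h, γ ((α * swap a b) h) = γ h) :
    ∑ c, numCycles (σ * colorRestrict γ (α * swap a b) hcol' c) +
        2 * (components σ α).numClasses ≤
      ∑ c, numCycles (σ * colorRestrict γ α hcol c) +
        2 * (components σ (α * swap a b)).numClasses + 1 := by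
  have hsum : ∑ c ∈ Finset.univ.erase (γ a),
        numCycles (σ * colorRestrict γ (α * swap a b) hcol' c) =
      ∑ c ∈ Finset.univ.erase (γ a), numCycles (σ * colorRestrict γ α hcol c) :=
    Finset.sum_congr rfl fun c hc => by
      rw [colorRestrict_mul_swap hab hcol hcol', if_neg (Finset.ne_of_mem_erase hc).symm, mul_one]
  rw [← Finset.add_sum_erase _ _ (Finset.mem_univ (γ a)), hsum,
    ← Finset.add_sum_erase _ _ (Finset.mem_univ (γ a)), colorRestrict_mul_swap hab hcol hcol',
    if_pos rfl, ← mul_assoc, components_mul_swap ha hb]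
  by_cases h : components σ α a b
  · rw [Setoid.join_eq_self h]
    have := numCycles_mul_swap_le (σ * colorRestrict γ α hcol (γ a)) a b
    omega
  · have := Setoid.numClasses_join_add_one h
    have := numCycles_mul_swap_add_one_of_not_sameCycle
      fun hs => h (sameCycleSetoid_mul_colorRestrict_le σ hcol (γ a) hs)
    omega

/-- The face-counting bound for maps with any number of components, where the fixed points of `α`
are half edges not belonging to an edge. -/
theorem two_mul_sum_numCycles_le (σ α : Perm S) (hinv : ∀ x, α (α x) = x)
    (hcol : ∀ h, γ (α h) = γ h) :
    2 * (∑ c, numCycles (σ * colorRestrict γ α hcol c)) + 4 * numCycles σ ≤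
      2 * (D * numCycles σ) + 4 * (components σ α).numClasses + α.support.card := by
  induction hn : α.support.card using Nat.strong_induction_on generalizing α with | _ n ih => ?_
  by_cases hα : α = 1
  · subst hα
    simp only [colorRestrict_one, mul_one, components_one_right, numClasses_sameCycleSetoid,
      Finset.sum_const, Finset.card_univ, Fintype.card_fin, smul_eq_mul]
    omega
  obtain ⟨a, ha⟩ : ∃ a, α a ≠ a := by
    by_contra! h
    exact hα (Equiv.ext h)
  obtain ⟨β, hβ⟩ : ∃ β, β = α * swap a (α a) := ⟨_, rfl⟩
  have hαβ : α = β * swap a (α a) := by rw [hβ, mul_assoc, swap_mul_self, mul_one]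
  have hβa : β a = a := by rw [hβ, mul_apply, swap_apply_left, hinv]
  have hβb : β (α a) = α a := by rw [hβ, mul_apply, swap_apply_right]
  have hβx : ∀ x, x ≠ a → x ≠ α a → β x = α x := fun x hxa hxb => by
    rw [hβ, mul_apply, swap_apply_of_ne_of_ne hxa hxb]
  have hβinv : ∀ x, β (β x) = x := by
    intro x
    rcases eq_or_ne x a with rfl | hxa
    · rw [hβa, hβa]
    rcases eq_or_ne x (α a) with rfl | hxb
    · rw [hβb, hβb]
    rw [hβx x hxa hxb, hβx, hinv]
    · exact fun h => hxb (by rw [← h, hinv])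
    · exact fun h => hxa (α.injective h)
  have hβcol : ∀ x, γ (β x) = γ x := by
    intro x
    rcases eq_or_ne x a with rfl | hxa
    · rw [hβa]
    rcases eq_or_ne x (α a) with rfl | hxb
    · rw [hβb]
    · rw [hβx x hxa hxb, hcol]
  have hsupp : β.support.card + 2 ≤ n := by
    have hsub : β.support ⊆ (α.support.erase a).erase (α a) := by
      intro x hx
      rw [mem_support] at hx
      have hxa : x ≠ a := fun h => hx (h ▸ hβa)
      have hxb : x ≠ α a := fun h => hx (h ▸ hβb)
      rw [hβx x hxa hxb] at hx
      exact Finset.mem_erase.2 ⟨hxb, Finset.mem_erase.2 ⟨hxa, mem_support.2 hx⟩⟩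
    have hcard := Finset.card_le_card hsub
    have ha_mem : a ∈ α.support := mem_support.2 ha
    have hb_mem : α a ∈ α.support.erase a :=
      Finset.mem_erase.2 ⟨ha, apply_mem_support.2 ha_mem⟩
    have h₁ := Finset.card_erase_add_one ha_mem
    have h₂ := Finset.card_erase_add_one hb_mem
    omega
  have hrec := ih _ (by omega) β hβinv hβcol rfl
  have hstep := sum_numCycles_mul_swap_le σ hβa hβb (hcol a).symm hβcol
    (fun x => by rw [← hαβ, hcol])
  simp only [← hαβ] at hstep
  omega

end FaceCounting

/-- Face-counting bound for closed connected edge `D`-colored combinatorial maps: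
if `σ` is the vertex permutation on a nonempty finite set `S` of half edges, `α` a
color-preserving fixed-point-free edge involution, the map is connected (the group
generated by `σ` and `α` acts transitively on `S`), `V` is the number of cycles of
`σ`, `E = |S|/2` the number of edges and `F = Σ_c #cycles(σ ∘ α_c)` the total number
of faces, then `F ≤ 2 + (D − 2)V + E`. -/
theorem face_counting_bound (D : ℕ) (hD : 1 ≤ D) (S : Type*) [Fintype S]
    [DecidableEq S] [Nonempty S] (γ : S → Fin D) (σ α : Equiv.Perm S)
    (hinv : α * α = 1) (hfp : ∀ h, α h ≠ h) (hcol : ∀ h, γ (α h) = γ h)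
    (htrans : ∀ x y : S,
      ∃ π ∈ Subgroup.closure ({σ, α} : Set (Equiv.Perm S)), π x = y) :
    ((∑ c, numCycles (σ * colorRestrict γ α hcol c) : ℕ) : ℤ)
      ≤ 2 + ((D : ℤ) - 2) * (numCycles σ : ℤ) + ((Fintype.card S / 2 : ℕ) : ℤ) := by
  have hinv' : ∀ x, α (α x) = x := fun x => by rw [← mul_apply, hinv, one_apply]
  have hbound := two_mul_sum_numCycles_le σ α hinv' hcol
  have hconn : (components σ α).numClasses = 1 := Setoid.numClasses_eq_one fun x y => by
    obtain ⟨π, hπ, rfl⟩ := htrans x y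
    exact components_of_mem_closure hπ x
  have hsupp : α.support.card ≤ Fintype.card S := Finset.card_le_univ _
  rw [hconn] at hbound
  rw [sub_mul]
  zify at hbound hsupp
  push_cast
  omega
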